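/- arXiv:1106.4597 — 4 statements merged into one kernel-verified Lean document; each statement's English description precedes it below -/
import Mathlib

section
/- Let d ≥ 2 and v ≥ d+1 be integers. Define h : {0,...,d} → ℕ by h_j = C(v-d-1+j, j) for 0 ≤ j ≤ ⌊d/2⌋ and h_j = h_{d-j} = C(v-1-j, d-j) for ⌊d/2⌋ < j ≤ d. Define F : {0,...,d} → ℕ by F_j = Σ_{i=0}^{d} C(d-i, d-j) · h_i (so that F_0, F_1, ..., F_d is the f-vector f_{-1}, f_0, ..., f_{d-1} of the cyclic polytope C(v,d)). Then the sequence F is log-concave: for every j with 1 ≤ j ≤ d-1, F_{j-1} · F_{j+1} ≤ F_j². -/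
/-- Iterated tail sums. -/
def cpG (a : ℕ → ℕ) : ℕ → ℕ → ℕ
  | 0, _ => 0
  | n + 1, 0 => a n + cpG a n 0
  | n + 1, k + 1 => cpG a n k + cpG a n (k + 1)

theorem cpG_eq (a : ℕ → ℕ) (n k : ℕ) :
    cpG a (n + 1) k = ∑ i ∈ Finset.range (n + 1), Nat.choose (n - i) k * a i := by
  induction n generalizing k with
  | zero =>
    cases k <;> simp [cpG]
  | succ n ih =>
    cases k with
    | zero =>
      rw [cpG, ih, Finset.sum_range_succ _ (n + 1)]
      simp [add_comm]
    | succ k =>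
      rw [cpG, ih, ih, Finset.sum_range_succ _ (n + 1), ← Finset.sum_add_distrib]
      simp only [Nat.sub_self, Nat.choose_zero_succ, zero_mul, add_zero]
      refine Finset.sum_congr rfl fun i hi => ?_
      have hi' : i ≤ n := by simpa [Nat.lt_succ_iff] using hi
      rw [Nat.succ_sub hi', Nat.choose_succ_succ]
      ring

theorem cp_main (a : ℕ → ℕ) (d : ℕ) (hpos : ∀ i, i ≤ d → 0 < a i)
    (hlc : ∀ i, i + 2 ≤ d → a i * a (i + 2) ≤ a (i + 1) ^ 2) :
    ∀ n, n ≤ d + 1 → ∀ k, cpG a n k * cpG a n (k + 2) ≤ cpG a n (k + 1) ^ 2 := by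
  have inv0 : ∀ n, n + 1 ≤ d → a (n + 1) * cpG a n 0 ≤ a n * (a n + cpG a n 0) := by
    intro n
    induction n with
    | zero => intro _; simp [cpG]
    | succ n ih =>
      intro hn
      have h1 := ih (by omega)
      have h2 := hlc n (by omega)
      have h3 := hpos (n + 1) (by omega)
      rw [cpG]
      generalize cpG a n 0 = s at *
      have h4 : a (n + 2) * s ≤ a (n + 1) * (a n + s) := by
        refine Nat.le_of_mul_le_mul_left ?_ h3
        calc a (n + 1) * (a (n + 2) * s) = a (n + 2) * (a (n + 1) * s) := by ring
          _ ≤ a (n + 2) * (a n * (a n + s)) := Nat.mul_le_mul_left _ h1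
          _ = (a n * a (n + 2)) * (a n + s) := by ring
          _ ≤ a (n + 1) ^ 2 * (a n + s) := Nat.mul_le_mul_right _ h2
          _ = _ := by ring
      show a (n + 2) * (a n + s) ≤ _
      nlinarith
  have inv1 : ∀ n, n ≤ d → a n * cpG a n 1 ≤ cpG a n 0 ^ 2 := by
    intro n
    induction n with
    | zero => intro _; simp [cpG]
    | succ n ih =>
      intro hn
      have h1 := ih (by omega)
      have h2 := inv0 n hn
      have h3 := hpos n (by omega)
      rw [cpG, cpG]
      simp only [zero_add]
      generalize cpG a n 0 = s at *
      generalize cpG a n 1 = t at *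
      have h4 : a (n + 1) * t ≤ s * (a n + s) := by
        refine Nat.le_of_mul_le_mul_left ?_ h3
        calc a n * (a (n + 1) * t) = a (n + 1) * (a n * t) := by ring
          _ ≤ a (n + 1) * s ^ 2 := Nat.mul_le_mul_left _ h1
          _ = (a (n + 1) * s) * s := by ring
          _ ≤ (a n * (a n + s)) * s := Nat.mul_le_mul_right _ h2
          _ = _ := by ring
      nlinarith
  have zer : ∀ n k, n ≤ k → cpG a n k = 0 := by
    intro n
    induction n with
    | zero => intro k _; simp [cpG]
    | succ n ih =>
      intro k hk
      obtain ⟨k, rfl⟩ : ∃ m, k = m + 1 := ⟨k - 1, by omega⟩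
      rw [cpG, ih k (by omega), ih (k + 1) (by omega)]
  have pos : ∀ n, n ≤ d + 1 → ∀ k, k < n → 0 < cpG a n k := by
    intro n
    induction n with
    | zero => intro _ k hk; omega
    | succ n ih =>
      intro hn k hk
      cases k with
      | zero => rw [cpG]; have := hpos n (by omega); omega
      | succ k => rw [cpG]; have := ih (by omega) k (by omega); omega
  intro n
  induction n with
  | zero => intro _ k; simp [cpG]
  | succ n ih =>
    intro hn k
    have ih := ih (by omega)
    cases k with
    | zero =>
      have h1 := inv1 n (by omega)
      have h2 := ih 0
      rw [cpG, cpG, cpG]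
      simp only [zero_add] at *
      rcases Nat.eq_zero_or_pos n with h0 | h0
      · subst h0; simp [cpG]
      have h3 := pos n (by omega) 0 h0
      generalize cpG a n 0 = p at *
      generalize cpG a n 1 = q at *
      show (a n + p) * (q + cpG a n 2) ≤ _
      generalize cpG a n 2 = r at *
      have h4 : a n * r ≤ p * q := by
        refine Nat.le_of_mul_le_mul_left ?_ h3
        calc p * (a n * r) = a n * (p * r) := by ring
          _ ≤ a n * q ^ 2 := Nat.mul_le_mul_left _ h2
          _ = (a n * q) * q := by ring
          _ ≤ p ^ 2 * q := Nat.mul_le_mul_right _ h1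
          _ = _ := by ring
      nlinarith
    | succ k =>
      have h1 := ih k
      have h2 := ih (k + 1)
      rw [cpG, cpG, cpG]
      show (cpG a n k + cpG a n (k + 1)) * (cpG a n (k + 2) + cpG a n (k + 3)) ≤
        (cpG a n (k + 1) + cpG a n (k + 2)) ^ 2
      change cpG a n (k + 1) * cpG a n (k + 3) ≤ cpG a n (k + 2) ^ 2 at h2
      rcases Nat.lt_or_ge (k + 2) n with h0 | h0
      · have h3 := pos n (by omega) (k + 1) (by omega)
        have h4 := pos n (by omega) (k + 2) (by omega)
        generalize cpG a n k = p at *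
        generalize cpG a n (k + 1) = q at *
        generalize cpG a n (k + 2) = r at *
        generalize cpG a n (k + 3) = s at *
        have h5 : p * s ≤ q * r := by
          refine Nat.le_of_mul_le_mul_left ?_ (Nat.mul_pos h3 h4)
          calc q * r * (p * s) = (p * r) * (q * s) := by ring
            _ ≤ q ^ 2 * r ^ 2 := Nat.mul_le_mul h1 h2
            _ = _ := by ring
        nlinarith
      · rw [zer n (k + 2) h0, zer n (k + 3) (by omega)]; simp

theorem cp_lc (N i : ℕ) : Nat.choose (N + i) i * Nat.choose (N + (i + 2)) (i + 2) ≤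
    Nat.choose (N + (i + 1)) (i + 1) ^ 2 := by
  have h1 := Nat.add_one_mul_choose_eq (N + i) i
  have h2 := Nat.add_one_mul_choose_eq (N + i + 1) (i + 1)
  rw [show N + (i + 2) = N + i + 1 + 1 by ring, show N + (i + 1) = N + i + 1 by ring]
  rw [show i + 2 = i + 1 + 1 by ring]
  generalize Nat.choose (N + i) i = x at *
  generalize Nat.choose (N + i + 1) (i + 1) = y at *
  generalize Nat.choose (N + i + 1 + 1) (i + 1 + 1) = z at *
  refine Nat.le_of_mul_le_mul_left ?_ (show 0 < (N + i + 1) * (i + 1 + 1) by positivity)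
  calc (N + i + 1) * (i + 1 + 1) * (x * z) = ((N + i + 1) * x) * (z * (i + 1 + 1)) := by ring
    _ = (y * (i + 1)) * ((N + i + 1 + 1) * y) := by rw [h1, h2]
    _ = ((i + 1) * (N + i + 1 + 1)) * y ^ 2 := by ring
    _ ≤ _ := Nat.mul_le_mul_right _ (by nlinarith)

theorem cp_mono (N : ℕ) : Monotone fun i => Nat.choose (N + i) i := by
  refine monotone_nat_of_le_succ fun i => ?_
  show Nat.choose (N + i) i ≤ Nat.choose (N + i + 1) (i + 1)
  rw [Nat.choose_succ_succ]
  omega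

/-- The f-vector of the cyclic polytope C(v,d) is log-concave. -/
theorem cyclic_polytope_f_vector_log_concave
    (d v : ℕ) (hd : 2 ≤ d) (hv : d + 1 ≤ v)
    (h F : ℕ → ℕ)
    (hh₁ : ∀ j, j ≤ d / 2 → h j = Nat.choose (v - d - 1 + j) j)
    (hh₂ : ∀ j, d / 2 < j → j ≤ d → h j = Nat.choose (v - 1 - j) (d - j))
    (hF : ∀ j, j ≤ d →
      F j = ∑ i ∈ Finset.range (d + 1), Nat.choose (d - i) (d - j) * h i) :
    ∀ j, 1 ≤ j → j ≤ d - 1 → F (j - 1) * F (j + 1) ≤ F j ^ 2 := by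
  obtain ⟨N, rfl⟩ : ∃ N, v = N + d + 1 := ⟨v - d - 1, by omega⟩
  have g1 : ∀ j, j ≤ d / 2 → h j = Nat.choose (N + j) j := by
    intro j hj
    rw [hh₁ j hj, show N + d + 1 - d - 1 = N by omega]
  have g2 : ∀ j, d / 2 < j → j ≤ d → h j = Nat.choose (N + (d - j)) (d - j) := by
    intro j hj hj'
    rw [hh₂ j hj hj', show N + d + 1 - 1 - j = N + (d - j) by omega]
  have hpos : ∀ i, i ≤ d → 0 < h i := by
    intro i hi
    rcases Nat.lt_or_ge (d / 2) i with hc | hc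
    · rw [g2 i hc hi]; exact Nat.choose_pos (by omega)
    · rw [g1 i hc]; exact Nat.choose_pos (by omega)
  have hlc : ∀ i, i + 2 ≤ d → h i * h (i + 2) ≤ h (i + 1) ^ 2 := by
    intro i hi
    rcases Nat.lt_or_ge (d / 2) i with hc | hc
    · rw [g2 i hc (by omega), g2 (i + 1) (by omega) (by omega), g2 (i + 2) (by omega) hi]
      have := cp_lc N (d - (i + 2))
      rw [show d - (i + 1) = d - (i + 2) + 1 by omega, show d - i = d - (i + 2) + 2 by omega]
      rw [mul_comm]; exact this
    rcases Nat.lt_or_ge (d / 2) (i + 1) with hc1 | hc1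
    · rw [g1 i hc, g2 (i + 1) hc1 (by omega), g2 (i + 2) (by omega) hi]
      rcases Nat.even_or_odd' d with ⟨m, hm | hm⟩
      · have := cp_lc N (d - (i + 2))
        rw [mul_comm, show d - (i + 1) = d - (i + 2) + 1 by omega]
        have e : Nat.choose (N + i) i =
            Nat.choose (N + (d - (i + 2) + 2)) (d - (i + 2) + 2) := by
          rw [show d - (i + 2) + 2 = i by omega]
        rw [e]; exact this
      · rw [sq]
        exact Nat.mul_le_mul (cp_mono N (show i ≤ d - (i + 1) by omega))
          (cp_mono N (show d - (i + 2) ≤ d - (i + 1) by omega))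
    rcases Nat.lt_or_ge (d / 2) (i + 2) with hc2 | hc2
    · rw [g1 i hc, g1 (i + 1) hc1, g2 (i + 2) hc2 hi, sq]
      exact Nat.mul_le_mul (cp_mono N (show i ≤ i + 1 by omega))
          (cp_mono N (show d - (i + 2) ≤ i + 1 by omega))
    · rw [g1 i hc, g1 (i + 1) hc1, g1 (i + 2) hc2]
      exact cp_lc N i
  intro j hj1 hj2
  have key := cp_main h d hpos hlc (d + 1) le_rfl (d - (j + 1))
  rw [hF _ (by omega), hF _ (by omega), hF _ (by omega), ← cpG_eq, ← cpG_eq, ← cpG_eq,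
    show d - (j - 1) = d - (j + 1) + 2 by omega, show d - j = d - (j + 1) + 1 by omega, mul_comm]
  exact key
end

section
/- Let d ≥ 2 and v ≥ d+1 be integers. Define h : {0,...,d} → ℕ by h_j = C(v-d-1+j, j) for 0 ≤ j ≤ ⌊d/2⌋ and h_j = h_{d-j} = C(v-1-j, d-j) for ⌊d/2⌋ < j ≤ d. Define F : {0,...,d} → ℕ by F_j = Σ_{i=0}^{d} C(d-i, d-j) · h_i (so that F_0, F_1, ..., F_d is the f-vector f_{-1}, f_0, ..., f_{d-1} of the cyclic polytope C(v,d)). Then the sequence F is unimodal: there exists m with 0 ≤ m ≤ d such that F_j ≤ F_{j+1} for all 0 ≤ j < m and F_j ≥ F_{j+1} for all m ≤ j < d. -/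
def cycT (h : ℕ → ℕ) : ℕ → ℕ → ℕ
  | 0, 0 => h 0
  | 0, _ + 1 => 0
  | k + 1, 0 => h (k + 1)
  | k + 1, r + 1 => cycT h k r + cycT h k (r + 1)

theorem cycT_zero (h : ℕ → ℕ) (k : ℕ) : cycT h k 0 = h k := by
  cases k <;> simp [cycT]

theorem cycT_ss (h : ℕ → ℕ) (k r : ℕ) :
    cycT h (k + 1) (r + 1) = cycT h k r + cycT h k (r + 1) := by
  simp [cycT]

theorem cycT_gt (h : ℕ → ℕ) (k : ℕ) : ∀ r, k < r → cycT h k r = 0 := by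
  induction k with
  | zero => intro r hr; obtain ⟨s, rfl⟩ : ∃ s, r = s + 1 := ⟨r - 1, by omega⟩; simp [cycT]
  | succ k ih =>
    intro r hr
    obtain ⟨s, rfl⟩ : ∃ s, r = s + 1 := ⟨r - 1, by omega⟩
    rw [cycT_ss, ih s (by omega), ih (s + 1) (by omega)]

theorem cycT_pos (h : ℕ → ℕ) (d : ℕ) (hp : ∀ k, k ≤ d → 0 < h k) (k : ℕ) :
    ∀ r, k ≤ d + 1 → r ≤ k → (k = d + 1 → 0 < r) → 0 < cycT h k r := by
  induction k with
  | zero =>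
    intro r _ hr _
    obtain rfl : r = 0 := by omega
    rw [cycT_zero]; exact hp 0 (by omega)
  | succ k ih =>
    intro r hk hr hr0
    cases r with
    | zero => rw [cycT_zero]; apply hp; by_contra hc; exact absurd (hr0 (by omega)) (by simp)
    | succ s =>
      rw [cycT_ss]
      have := ih s (by omega) (by omega) (by omega)
      omega

theorem cycT_sum (h : ℕ → ℕ) (k : ℕ) : ∀ r,
    cycT h (k + 1) (r + 1) = ∑ i ∈ Finset.range (k + 1), Nat.choose (k - i) r * h i := by
  induction k with
  | zero =>
    intro r
    rw [cycT_ss]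
    cases r <;> simp [cycT]
  | succ k ih =>
    intro r
    rw [cycT_ss, Finset.sum_range_succ, ih r]
    cases r with
    | zero => rw [cycT_zero]; simp [add_comm]
    | succ s =>
      rw [ih s]
      simp only [Nat.sub_self, Nat.choose_zero_succ, zero_mul, add_zero]
      rw [← Finset.sum_add_distrib]
      apply Finset.sum_congr rfl
      intro i hi
      have hi' : i < k + 1 := Finset.mem_range.mp hi
      rw [show k + 1 - i = (k - i) + 1 by omega, Nat.choose_succ_succ]
      ring

theorem cycT_col (h : ℕ → ℕ) (d : ℕ) (hp : ∀ k, k ≤ d → 0 < h k)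
    (hl : ∀ k, k + 2 ≤ d → h k * h (k + 2) ≤ h (k + 1) ^ 2) (k : ℕ) :
    k + 1 ≤ d → h (k + 1) * cycT h k 1 ≤ h k * cycT h (k + 1) 1 := by
  induction k with
  | zero => intro _; simp [cycT]
  | succ k ih =>
    intro hk
    have h1 := ih (by omega)
    have h2 := hl k (by omega)
    have e1 := cycT_ss h k 0
    have e2 := cycT_ss h (k + 1) 0
    rw [cycT_zero] at e1 e2
    simp only [zero_add] at e1 e2
    have p := hp k (by omega)
    apply Nat.le_of_mul_le_mul_left _ p
    rw [e2]
    generalize cycT h (k + 1) 1 = S at *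
    generalize cycT h k 1 = R at *
    show h k * (h (k + 2) * S) ≤ h k * (h (k + 1) * (h (k + 1) + S))
    have a1 := Nat.mul_le_mul_right S h2
    have a2 := Nat.mul_le_mul_left (h (k + 1)) h1
    subst e1
    nlinarith

theorem cyc_step (a b c e : ℕ) (hz : b * c = 0 → e = 0)
    (h1 : a * c ≤ b ^ 2) (h2 : b * e ≤ c ^ 2) : (a + b) * (c + e) ≤ (b + c) ^ 2 := by
  have key : a * e ≤ b * c := by
    rcases Nat.eq_zero_or_pos (b * c) with h0 | h0
    · simp [hz h0]
    · apply Nat.le_of_mul_le_mul_left _ h0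
      have := Nat.mul_le_mul h1 h2
      nlinarith
  nlinarith

theorem cycT_lc_step (h : ℕ → ℕ) (d : ℕ) (hp : ∀ k, k ≤ d → 0 < h k) (k : ℕ) (hk : k ≤ d)
    (ih : ∀ r, cycT h k r * cycT h k (r + 2) ≤ cycT h k (r + 1) ^ 2) (r : ℕ) :
    cycT h (k + 1) (r + 1) * cycT h (k + 1) (r + 3) ≤ cycT h (k + 1) (r + 2) ^ 2 := by
  rw [cycT_ss, cycT_ss, cycT_ss]
  apply cyc_step _ _ _ _ _ (ih r) (ih (r + 1))
  intro h0
  apply cycT_gt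
  by_contra hc
  have p1 := cycT_pos h d hp k (r + 1) (by omega) (by omega) (by omega)
  have p2 := cycT_pos h d hp k (r + 2) (by omega) (by omega) (by omega)
  have := Nat.mul_pos p1 p2
  have h0' : cycT h k (r + 1) * cycT h k (r + 2) = 0 := h0
  omega

theorem cycT_lc (h : ℕ → ℕ) (d : ℕ) (hp : ∀ k, k ≤ d → 0 < h k)
    (hl : ∀ k, k + 2 ≤ d → h k * h (k + 2) ≤ h (k + 1) ^ 2) (k : ℕ) : k ≤ d →
    ∀ r, cycT h k r * cycT h k (r + 2) ≤ cycT h k (r + 1) ^ 2 := by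
  induction k with
  | zero => intro _ r; simp [cycT]
  | succ k ih =>
    intro hk r
    have ih := ih (by omega)
    cases r with
    | succ s => exact cycT_lc_step h d hp k (by omega) ih s
    | zero =>
      rcases Nat.eq_zero_or_pos k with rfl | hk0
      · rw [cycT_gt h (0 + 1) (0 + 2) (by omega)]; simp
      have c := cycT_col h d hp hl k hk
      have i0 := ih 0
      have p := cycT_pos h d hp k 1 (by omega) (by omega) (by omega)
      have e1 : cycT h (k + 1) 1 = h k + cycT h k 1 := by
        have := cycT_ss h k 0
        rwa [cycT_zero] at this
      have e2 : cycT h (k + 1) 2 = cycT h k 1 + cycT h k 2 := cycT_ss h k 1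
      rw [cycT_zero] at i0
      simp only [zero_add] at *
      rw [cycT_zero, e2, e1]
      rw [e1] at c
      generalize cycT h k 1 = S at *
      generalize cycT h k 2 = A at *
      generalize h k = x at *
      generalize h (k + 1) = y at *
      apply Nat.le_of_mul_le_mul_left _ p
      have a1 := Nat.mul_le_mul_right (S + A) c
      have a2 := Nat.mul_le_mul_right (x + S) i0
      nlinarith

theorem cyc_g_mono (n a b : ℕ) (hab : a ≤ b) : (n + a).choose a ≤ (n + b).choose b := by
  have e1 := Nat.choose_symm_add (a := n) (b := a)
  have e2 := Nat.choose_symm_add (a := n) (b := b)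
  rw [← e1, ← e2]
  exact Nat.choose_le_choose n (by omega)

theorem cyc_g_lc (n k : ℕ) :
    (n + k).choose k * (n + (k + 2)).choose (k + 2) ≤ (n + (k + 1)).choose (k + 1) ^ 2 := by
  have e1 : (n + k + 1) * (n + k).choose k = (n + (k + 1)).choose (k + 1) * (k + 1) :=
    Nat.add_one_mul_choose_eq (n + k) k
  have e2 : (n + k + 2) * (n + (k + 1)).choose (k + 1)
      = (n + (k + 2)).choose (k + 2) * (k + 2) :=
    Nat.add_one_mul_choose_eq (n + (k + 1)) (k + 1)
  generalize (n + k).choose k = x at *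
  generalize (n + (k + 1)).choose (k + 1) = y at *
  generalize (n + (k + 2)).choose (k + 2) = z at *
  have hpos : 0 < (n + k + 1) * (k + 2) := by positivity
  apply Nat.le_of_mul_le_mul_left _ hpos
  calc (n + k + 1) * (k + 2) * (x * z) = ((n + k + 1) * x) * (z * (k + 2)) := by ring
    _ = (y * (k + 1)) * ((n + k + 2) * y) := by rw [e1, e2]
    _ = ((k + 1) * (n + k + 2)) * y ^ 2 := by ring
    _ ≤ (n + k + 1) * (k + 2) * y ^ 2 := by
      apply Nat.mul_le_mul_right
      nlinarith

theorem cyc_h_lc (n d : ℕ) (h : ℕ → ℕ)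
    (hh : ∀ j, j ≤ d → h j = (n + min j (d - j)).choose (min j (d - j))) (k : ℕ)
    (hk : k + 2 ≤ d) : h k * h (k + 2) ≤ h (k + 1) ^ 2 := by
  rw [hh k (by omega), hh (k + 1) (by omega), hh (k + 2) hk]
  by_cases hA : k + 2 ≤ d - (k + 2)
  · rw [min_eq_left hA, min_eq_left (by omega), min_eq_left (by omega)]
    exact cyc_g_lc n k
  by_cases hB : d - k ≤ k
  · rw [min_eq_right hB, min_eq_right (by omega), min_eq_right (by omega)]
    have := cyc_g_lc n (d - (k + 2))
    rw [show d - (k + 2) + 2 = d - k by omega, show d - (k + 2) + 1 = d - (k + 1) by omega] at this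
    rw [mul_comm]; exact this
  rw [sq]
  exact Nat.mul_le_mul (cyc_g_mono n _ _ (by omega)) (cyc_g_mono n _ _ (by omega))

theorem cyc_unimodal (d : ℕ) (F : ℕ → ℕ) (hp : ∀ j, j ≤ d → 0 < F j)
    (hl : ∀ j, j + 2 ≤ d → F j * F (j + 2) ≤ F (j + 1) ^ 2) :
    ∃ m, m ≤ d ∧ (∀ j, j < m → F j ≤ F (j + 1)) ∧
      (∀ j, m ≤ j → j < d → F (j + 1) ≤ F j) := by
  classical
  by_cases hex : ∃ j, j < d ∧ F (j + 1) < F j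
  · obtain ⟨hm1, hm2⟩ := Nat.find_spec hex
    refine ⟨Nat.find hex, by omega, ?_, ?_⟩
    · intro j hj
      have := Nat.find_min hex hj
      by_contra hc
      exact this ⟨by omega, by omega⟩
    · intro j hj
      induction j, hj using Nat.le_induction with
      | base => intro _; omega
      | succ j hj ih =>
        intro hjd
        have i := ih (by omega)
        have l := hl j (by omega)
        apply Nat.le_of_mul_le_mul_left _ (hp j (by omega))
        calc F j * F (j + 1 + 1) ≤ F (j + 1) ^ 2 := l
          _ = F (j + 1) * F (j + 1) := sq _
          _ ≤ F j * F (j + 1) := Nat.mul_le_mul_right _ i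
  · push Not at hex
    exact ⟨d, le_rfl, fun j hj => hex j hj, fun j h1 h2 => by omega⟩

/-- The f-vector of the cyclic polytope C(v,d) is unimodal. -/
theorem cyclic_polytope_f_vector_unimodal
    (d v : ℕ) (hd : 2 ≤ d) (hv : d + 1 ≤ v)
    (h F : ℕ → ℕ)
    (hh₁ : ∀ j, j ≤ d / 2 → h j = Nat.choose (v - d - 1 + j) j)
    (hh₂ : ∀ j, d / 2 < j → j ≤ d → h j = Nat.choose (v - 1 - j) (d - j))
    (hF : ∀ j, j ≤ d →
      F j = ∑ i ∈ Finset.range (d + 1), Nat.choose (d - i) (d - j) * h i) :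
    ∃ m, m ≤ d ∧ (∀ j, j < m → F j ≤ F (j + 1)) ∧
      (∀ j, m ≤ j → j < d → F (j + 1) ≤ F j) := by
  have hh : ∀ j, j ≤ d →
      h j = ((v - d - 1) + min j (d - j)).choose (min j (d - j)) := by
    intro j hj
    by_cases hjd : j ≤ d / 2
    · rw [hh₁ j hjd, min_eq_left (by omega)]
    · rw [hh₂ j (by omega) hj, min_eq_right (by omega),
        show v - 1 - j = v - d - 1 + (d - j) by omega]
  have hp : ∀ k, k ≤ d → 0 < h k := by
    intro k hk
    rw [hh k hk]
    exact Nat.choose_pos (by omega)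
  have hl := cyc_h_lc (v - d - 1) d h hh
  have hT : ∀ j, j ≤ d → F j = cycT h (d + 1) (d - j + 1) := by
    intro j hj
    rw [hF j hj, cycT_sum]
  apply cyc_unimodal
  · intro j hj
    rw [hT j hj]
    exact cycT_pos h d hp (d + 1) _ (by omega) (by omega) (by omega)
  · intro j hj
    have := cycT_lc_step h d hp d le_rfl (cycT_lc h d hp hl d le_rfl) (d - (j + 2))
    rw [hT j (by omega), hT (j + 1) (by omega), hT (j + 2) hj, mul_comm,
      show d - j + 1 = d - (j + 2) + 3 by omega,
      show d - (j + 1) + 1 = d - (j + 2) + 2 by omega]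
    exact this
end

section
/- Let a, b, c, d be positive real numbers such that b² ≥ a·c and c² ≥ b·d. Then (a+b)·(c+d) ≤ (b+c)². -/
theorem interior_dip_ineq (a b c d : ℝ)
    (ha : 0 < a) (hb : 0 < b) (hc : 0 < c) (hd : 0 < d)
    (h1 : a * c ≤ b ^ 2) (h2 : b * d ≤ c ^ 2) :
    (a + b) * (c + d) ≤ (b + c) ^ 2 := by
  have h3 : (a * c) * (b * d) ≤ b ^ 2 * c ^ 2 :=
    mul_le_mul h1 h2 (by positivity) (by positivity)
  have h4 : a * d ≤ b * c := by
    have hbc : 0 < b * c := mul_pos hb hc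
    refine le_of_mul_le_mul_right ?_ hbc
    linarith [h3, (by ring : a * d * (b * c) = (a * c) * (b * d)),
      (by ring : b * c * (b * c) = b ^ 2 * c ^ 2)]
  linarith [(by ring : (a + b) * (c + d) = a * c + a * d + b * c + b * d),
    (by ring : (b + c) ^ 2 = b ^ 2 + 2 * (b * c) + c ^ 2)]
end

section
/- Let n ≥ 1 and let a_0, a_1, ..., a_n be positive real numbers forming a log-concave sequence (a_{i-1} a_{i+1} ≤ a_i² for all 0 < i < n). Let e be a real number with 0 < e ≤ a_n. Define b_0, b_1, ..., b_{n+1} by b_0 = a_0, b_j = a_{j-1} + a_j for 1 ≤ j ≤ n, and b_{n+1} = e. Then the sequence b_0, ..., b_{n+1} is log-concave: b_{j-1} b_{j+1} ≤ b_j² for all 0 < j < n+1. -/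
/-- The Pascal-rule row operation (with a small appended entry) preserves
log-concavity of positive sequences. -/
theorem pascal_step_preserves_log_concave
    (n : ℕ) (hn : 1 ≤ n) (a : ℕ → ℝ) (e : ℝ)
    (ha : ∀ i, i ≤ n → 0 < a i)
    (hlc : ∀ i, 0 < i → i < n → a (i - 1) * a (i + 1) ≤ a i ^ 2)
    (he : 0 < e) (hea : e ≤ a n)
    (b : ℕ → ℝ)
    (hb0 : b 0 = a 0)
    (hbj : ∀ j, 1 ≤ j → j ≤ n → b j = a (j - 1) + a j)
    (hbn : b (n + 1) = e) :
    ∀ j, 0 < j → j < n + 1 → b (j - 1) * b (j + 1) ≤ b j ^ 2 := by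
  intro j hj hjn
  obtain ⟨k, rfl⟩ : ∃ k, j = k + 1 := ⟨j - 1, by omega⟩
  have h1 := hbj (k + 1) (by omega) (by omega)
  simp only [Nat.add_sub_cancel] at h1 ⊢
  rw [h1]
  have p0 := ha k (by omega)
  have p1 := ha (k + 1) (by omega)
  rcases k with _ | m
  · rw [hb0]
    simp only [Nat.zero_add] at *
    by_cases hn1 : n = 1
    · subst hn1
      rw [hbn]
      nlinarith [mul_le_mul_of_nonneg_left hea p0.le, mul_pos p0 p1, sq_nonneg (a 0), sq_nonneg (a 1)]
    · have h2 := hbj (1 + 1) (by omega) (by omega)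
      have l1 := hlc 1 (by omega) (by omega)
      simp only [Nat.add_sub_cancel, Nat.sub_self] at h2 l1
      rw [h2]
      nlinarith [mul_pos p0 p1, sq_nonneg (a 0)]
  · have h0 := hbj (m + 1) (by omega) (by omega)
    have l1 := hlc (m + 1) (by omega) (by omega)
    have px := ha m (by omega)
    simp only [Nat.add_sub_cancel] at h0 l1
    rw [h0]
    by_cases hn1 : n = m + 1 + 1
    · subst hn1
      rw [hbn]
      nlinarith [mul_le_mul_of_nonneg_left hea (add_pos px p0).le, mul_pos p0 p1, sq_nonneg (a (m + 1 + 1))]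
    · have h2 := hbj (m + 1 + 1 + 1) (by omega) (by omega)
      have l2 := hlc (m + 1 + 1) (by omega) (by omega)
      have pw := ha (m + 1 + 1 + 1) (by omega)
      simp only [Nat.add_sub_cancel] at h2 l2
      rw [h2]
      have key : a m * a (m + 1 + 1 + 1) ≤ a (m + 1) * a (m + 1 + 1) := by
        have hm := mul_le_mul l1 l2 (mul_pos p0 pw).le (sq_nonneg _)
        refine le_of_mul_le_mul_right ?_ (mul_pos p0 p1)
        nlinarith [hm]
      nlinarith
end
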